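/- Let A1, A2, A3 ∈ 𝔹 be pairwise distinct and not collinear in ℝⁿ, let m1 = (γ12 + γ13 − γ23 − 1)(γ23 − 1), m2 = (γ12 − γ13 + γ23 − 1)(γ13 − 1), m3 = (−γ12 + γ13 + γ23 − 1)(γ12 − 1), assume D := m1·γ_{A1} + m2·γ_{A2} + m3·γ_{A3} ≠ 0 and that O = (m1·γ_{A1}·A1 + m2·γ_{A2}·A2 + m3·γ_{A3}·A3)/D lies in 𝔹. Let R = ‖⊖A1 ⊕ O‖ be the circumgyroradius and γ_R = 1/√(1 − R²/s²). With D3 = 1 + 2γ12γ13γ23 − γ12² − γ13² − γ23² and H3 = 2(γ12 − 1)(γ13 − 1)(γ23 − 1), one has γ_R² = D3/(D3 − H3) and R² = s²·H3/D3 = 2s²(γ12 − 1)(γ13 − 1)(γ23 − 1)/(1 + 2γ12γ13γ23 − γ12² − γ13² − γ23²). -/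

import Mathlib

open RealInnerProductSpace

/-- Lorentz gamma factor of a vector `v` in the `s`-ball of `ℝⁿ`. -/
noncomputable def egamma {n : ℕ} (s : ℝ) (v : EuclideanSpace ℝ (Fin n)) : ℝ :=
  1 / Real.sqrt (1 - ‖v‖ ^ 2 / s ^ 2)

/-- Einstein addition on the `s`-ball of `ℝⁿ`. -/
noncomputable def eadd {n : ℕ} (s : ℝ) (u v : EuclideanSpace ℝ (Fin n)) :
    EuclideanSpace ℝ (Fin n) :=
  (1 / (1 + ⟪u, v⟫ / s ^ 2)) •
    (u + (1 / egamma s u) • v + (egamma s u / (s ^ 2 * (1 + egamma s u))) • ⟪u, v⟫ • u)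

/-- Gyroangle at vertex `X` between points `Y` and `Z`. -/
noncomputable def gyroangle {n : ℕ} (s : ℝ) (X Y Z : EuclideanSpace ℝ (Fin n)) : ℝ :=
  Real.arccos ⟪‖eadd s (-X) Y‖⁻¹ • eadd s (-X) Y, ‖eadd s (-X) Z‖⁻¹ • eadd s (-X) Z⟫

/-- Gamma factor of a real gyrodistance `d`. -/
noncomputable def gammaR (s d : ℝ) : ℝ := 1 / Real.sqrt (1 - d ^ 2 / s ^ 2)

theorem one_sub_norm_sq_div_pos {n : ℕ} {s : ℝ} {v : EuclideanSpace ℝ (Fin n)}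
    (hv : ‖v‖ < s) : 0 < 1 - ‖v‖ ^ 2 / s ^ 2 := by
  have hs : 0 < s := (norm_nonneg v).trans_lt hv
  rw [sub_pos, div_lt_one (by positivity)]
  gcongr

theorem egamma_pos {n : ℕ} {s : ℝ} {v : EuclideanSpace ℝ (Fin n)} (hv : ‖v‖ < s) :
    0 < egamma s v :=
  one_div_pos.mpr (Real.sqrt_pos.mpr (one_sub_norm_sq_div_pos hv))

theorem one_sub_norm_sq_div_eq {n : ℕ} {s : ℝ} {v : EuclideanSpace ℝ (Fin n)}
    (hv : ‖v‖ < s) : 1 - ‖v‖ ^ 2 / s ^ 2 = 1 / egamma s v ^ 2 := by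
  simp [egamma, Real.sq_sqrt (one_sub_norm_sq_div_pos hv).le]

theorem one_sub_inner_div_pos {n : ℕ} {s : ℝ} {u v : EuclideanSpace ℝ (Fin n)}
    (hu : ‖u‖ < s) (hv : ‖v‖ < s) : 0 < 1 - ⟪u, v⟫ / s ^ 2 := by
  have hs : 0 < s := (norm_nonneg v).trans_lt hv
  rw [sub_pos, div_lt_one (by positivity)]
  calc ⟪u, v⟫ ≤ ‖u‖ * ‖v‖ := real_inner_le_norm u v
    _ < s * s := mul_lt_mul'' hu hv (norm_nonneg u) (norm_nonneg v)
    _ = s ^ 2 := (sq s).symm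

theorem egamma_neg {n : ℕ} (s : ℝ) (v : EuclideanSpace ℝ (Fin n)) :
    egamma s (-v) = egamma s v := by
  simp [egamma]

theorem one_sub_norm_sq_eadd_neg {n : ℕ} {s : ℝ} {u v : EuclideanSpace ℝ (Fin n)}
    (hu : ‖u‖ < s) (hv : ‖v‖ < s) :
    1 - ‖eadd s (-u) v‖ ^ 2 / s ^ 2 =
      (1 / (egamma s u * egamma s v * (1 - ⟪u, v⟫ / s ^ 2))) ^ 2 := by
  have hs : 0 < s := (norm_nonneg v).trans_lt hv
  have hg := egamma_pos hu
  have hc := one_sub_inner_div_pos hu hv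
  have hnu : ‖u‖ ^ 2 = s ^ 2 * (1 - 1 / egamma s u ^ 2) := by
    rw [← one_sub_norm_sq_div_eq hu]; field_simp; ring
  have hnv : ‖v‖ ^ 2 = s ^ 2 * (1 - 1 / egamma s v ^ 2) := by
    rw [← one_sub_norm_sq_div_eq hv]; field_simp; ring
  have hh := egamma_pos hv
  have hnorm : ‖eadd s (-u) v‖ ^ 2 = (1 / (1 - ⟪u, v⟫ / s ^ 2)) ^ 2 *
      ((1 - egamma s u / (s ^ 2 * (1 + egamma s u)) * ⟪u, v⟫) ^ 2 * ‖u‖ ^ 2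
        + (1 / egamma s u) ^ 2 * ‖v‖ ^ 2
        - 2 * (1 - egamma s u / (s ^ 2 * (1 + egamma s u)) * ⟪u, v⟫)
          * (1 / egamma s u) * ⟪u, v⟫) := by
    have hw : eadd s (-u) v = (1 / (1 - ⟪u, v⟫ / s ^ 2)) •
        ((1 / egamma s u) • v
          - (1 - egamma s u / (s ^ 2 * (1 + egamma s u)) * ⟪u, v⟫) • u) := by
      rw [eadd, egamma_neg, inner_neg_left, neg_div, ← sub_eq_add_neg]
      module
    rw [hw, norm_smul, mul_pow, Real.norm_eq_abs, sq_abs, norm_sub_sq_real, norm_smul,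
      norm_smul, inner_smul_left, inner_smul_right, real_inner_comm, mul_pow, mul_pow,
      Real.norm_eq_abs, Real.norm_eq_abs, sq_abs, sq_abs]
    simp only [conj_trivial]
    ring
  rw [hnorm, hnu, hnv]
  generalize ⟪u, v⟫ = c at *
  generalize egamma s u = g at *
  generalize egamma s v = h at *
  have hc' : s ^ 2 - c ≠ 0 := by
    have : s ^ 2 - c = s ^ 2 * (1 - c / s ^ 2) := by field_simp
    rw [this]; positivity
  have hg' : 1 + g ≠ 0 := by positivity
  field_simp
  ring

theorem egamma_eadd_neg {n : ℕ} {s : ℝ} {u v : EuclideanSpace ℝ (Fin n)}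
    (hu : ‖u‖ < s) (hv : ‖v‖ < s) :
    egamma s (eadd s (-u) v) = egamma s u * egamma s v * (1 - ⟪u, v⟫ / s ^ 2) := by
  have hpos := mul_pos (mul_pos (egamma_pos hu) (egamma_pos hv)) (one_sub_inner_div_pos hu hv)
  rw [egamma, one_sub_norm_sq_eadd_neg hu hv, Real.sqrt_sq (one_div_pos.mpr hpos).le,
    one_div_one_div]

/-- **Circumgyroradius formula.** -/
theorem circumgyroradius_formula {n : ℕ} (hn : 2 ≤ n) (s : ℝ) (hs : 0 < s)
    (A1 A2 A3 O : EuclideanSpace ℝ (Fin n))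
    (hA1 : ‖A1‖ < s) (hA2 : ‖A2‖ < s) (hA3 : ‖A3‖ < s)
    (h12 : A1 ≠ A2) (h13 : A1 ≠ A3) (h23 : A2 ≠ A3)
    (hncol : ¬ Collinear ℝ ({A1, A2, A3} : Set (EuclideanSpace ℝ (Fin n))))
    (γ12 γ13 γ23 m1 m2 m3 D D3 H3 R : ℝ)
    (hγ12 : γ12 = egamma s (eadd s (-A1) A2))
    (hγ13 : γ13 = egamma s (eadd s (-A1) A3))
    (hγ23 : γ23 = egamma s (eadd s (-A2) A3))
    (hm1 : m1 = (γ12 + γ13 - γ23 - 1) * (γ23 - 1))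
    (hm2 : m2 = (γ12 - γ13 + γ23 - 1) * (γ13 - 1))
    (hm3 : m3 = (-γ12 + γ13 + γ23 - 1) * (γ12 - 1))
    (hD : D = m1 * egamma s A1 + m2 * egamma s A2 + m3 * egamma s A3)
    (hDne : D ≠ 0)
    (hO : O = D⁻¹ • ((m1 * egamma s A1) • A1 + (m2 * egamma s A2) • A2 +
      (m3 * egamma s A3) • A3))
    (hOball : ‖O‖ < s)
    (hR : R = ‖eadd s (-A1) O‖)
    (hD3 : D3 = 1 + 2 * γ12 * γ13 * γ23 - γ12 ^ 2 - γ13 ^ 2 - γ23 ^ 2)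
    (hH3 : H3 = 2 * (γ12 - 1) * (γ13 - 1) * (γ23 - 1)) :
    (gammaR s R) ^ 2 = D3 / (D3 - H3) ∧
    R ^ 2 = s ^ 2 * H3 / D3 ∧
    R ^ 2 = 2 * s ^ 2 * ((γ12 - 1) * (γ13 - 1) * (γ23 - 1)) /
      (1 + 2 * γ12 * γ13 * γ23 - γ12 ^ 2 - γ13 ^ 2 - γ23 ^ 2) := by
  have e12 := hγ12.trans (egamma_eadd_neg hA1 hA2)
  have e13 := hγ13.trans (egamma_eadd_neg hA1 hA3)
  have e23 := hγ23.trans (egamma_eadd_neg hA2 hA3)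
  have e1 := one_sub_norm_sq_div_eq hA1
  have e2 := one_sub_norm_sq_div_eq hA2
  have e3 := one_sub_norm_sq_div_eq hA3
  have hg1 := egamma_pos hA1
  have hg2 := egamma_pos hA2
  have hg3 := egamma_pos hA3
  have hgO := egamma_pos hOball
  have hnO := one_sub_norm_sq_div_eq hOball
  have hRO := one_sub_norm_sq_eadd_neg hA1 hOball
  have hcO := one_sub_inner_div_pos hA1 hOball
  rw [← hR] at hRO
  rw [eq_div_iff (by positivity)] at e1 e2 e3
  have hDO : D • O = (m1 * egamma s A1) • A1 + (m2 * egamma s A2) • A2 +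
      (m3 * egamma s A3) • A3 := by
    rw [hO, smul_inv_smul₀ hDne]
  have hinner : D * ⟪A1, O⟫ = m1 * egamma s A1 * ‖A1‖ ^ 2 + m2 * egamma s A2 * ⟪A1, A2⟫
      + m3 * egamma s A3 * ⟪A1, A3⟫ := by
    rw [← real_inner_smul_right, hDO]
    simp only [inner_add_right, real_inner_smul_right, real_inner_self_eq_norm_sq]
  have hnorm : D ^ 2 * ‖O‖ ^ 2 = (m1 * egamma s A1) ^ 2 * ‖A1‖ ^ 2
      + (m2 * egamma s A2) ^ 2 * ‖A2‖ ^ 2 + (m3 * egamma s A3) ^ 2 * ‖A3‖ ^ 2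
      + 2 * (m1 * egamma s A1) * (m2 * egamma s A2) * ⟪A1, A2⟫
      + 2 * (m1 * egamma s A1) * (m3 * egamma s A3) * ⟪A1, A3⟫
      + 2 * (m2 * egamma s A2) * (m3 * egamma s A3) * ⟪A2, A3⟫ := by
    have h : D ^ 2 * ‖O‖ ^ 2 = ⟪D • O, D • O⟫ := by
      rw [real_inner_smul_left, real_inner_smul_right, real_inner_self_eq_norm_sq]; ring
    rw [h, hDO]
    simp only [inner_add_right, inner_add_left, real_inner_smul_right, real_inner_smul_left,
      real_inner_self_eq_norm_sq, real_inner_comm A1 A2, real_inner_comm A1 A3,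
      real_inner_comm A2 A3, norm_smul, mul_pow, Real.norm_eq_abs, sq_abs]
    ring
  -- The Lorentz products of `∑ mᵢ γ_{Aᵢ} (1, Aᵢ / s)` with its first term and with itself.
  have hprod : egamma s A1 * (D * (1 - ⟪A1, O⟫ / s ^ 2)) = D3 := by
    have h : egamma s A1 * (D * (1 - ⟪A1, O⟫ / s ^ 2)) = m1 + m2 * γ12 + m3 * γ13 := by
      have : D * (1 - ⟪A1, O⟫ / s ^ 2) = D - (D * ⟪A1, O⟫) / s ^ 2 := by ring
      rw [this, hinner, e12, e13, hD]
      linear_combination m1 * e1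
    rw [h, hm1, hm2, hm3, hD3]
    ring
  have hself : D ^ 2 * (1 - ‖O‖ ^ 2 / s ^ 2) = D3 * (D3 - H3) := by
    have h : D ^ 2 * (1 - ‖O‖ ^ 2 / s ^ 2) = m1 ^ 2 + m2 ^ 2 + m3 ^ 2
        + 2 * m1 * m2 * γ12 + 2 * m1 * m3 * γ13 + 2 * m2 * m3 * γ23 := by
      have : D ^ 2 * (1 - ‖O‖ ^ 2 / s ^ 2) = D ^ 2 - (D ^ 2 * ‖O‖ ^ 2) / s ^ 2 := by ring
      rw [this, hnorm, e12, e13, e23, hD]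
      linear_combination m1 ^ 2 * e1 + m2 ^ 2 * e2 + m3 ^ 2 * e3
    rw [h, hm1, hm2, hm3, hD3, hH3]
    ring
  have hself_pos : 0 < D3 * (D3 - H3) :=
    hself ▸ mul_pos (by positivity) (one_sub_norm_sq_div_pos hOball)
  have hD3ne : D3 ≠ 0 := left_ne_zero_of_mul hself_pos.ne'
  have hgR : 1 - R ^ 2 / s ^ 2 = (D3 - H3) / D3 := by
    rw [hnO] at hself
    rw [hRO, eq_div_iff hD3ne]
    apply mul_right_cancel₀ hD3ne
    rw [mul_comm (D3 - H3), ← hself, mul_assoc, ← hprod]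
    generalize 1 - ⟪A1, O⟫ / s ^ 2 = c at hcO ⊢
    field_simp
  have hR2 : R ^ 2 = s ^ 2 * H3 / D3 := by
    field_simp at hgR ⊢
    linear_combination -hgR
  refine ⟨?_, hR2, ?_⟩
  · have hnonneg : 0 ≤ 1 - R ^ 2 / s ^ 2 := hRO ▸ sq_nonneg _
    rw [gammaR, div_pow, one_pow, Real.sq_sqrt hnonneg, hgR, one_div_div]
  · rw [hR2, hH3, hD3]
    ring
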